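/- Soundness of the axiomatizations: if ⊢_{ICK} φ then φ is valid over the class of all epistemic frames; if ⊢_{ICKT} φ then φ is valid over the class of reflexive frames; if ⊢_{ICKS4} φ then φ is valid over the class of S4 frames; if ⊢_{ICKS5} φ then φ is valid over the class of S5 frames. -/

import Mathlib

namespace ICK

/-- Formulae of the language `L_ICK` over a type of agents and natural-number atoms. -/
inductive Formula (Agent : Type) : Type
  | bot : Formula Agent
  | atom : ℕ → Formula Agent
  | and : Formula Agent → Formula Agent → Formula Agent
  | or : Formula Agent → Formula Agent → Formula Agent
  | imp : Formula Agent → Formula Agent → Formula Agent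
  | know : Agent → Formula Agent → Formula Agent
  | ck : Formula Agent → Formula Agent

namespace Formula

variable {Agent : Type}

/-- `¬φ := φ → ⊥`. -/
def neg (φ : Formula Agent) : Formula Agent := φ.imp Formula.bot

/-- `⊤ := ⊥ → ⊥`. -/
def top : Formula Agent := Formula.imp Formula.bot Formula.bot

/-- `φ ↔ ψ := (φ → ψ) ∧ (ψ → φ)`. -/
def biimp (φ ψ : Formula Agent) : Formula Agent := (φ.imp ψ).and (ψ.imp φ)

end Formula

/-- The formula `E φ = ⋀_{a ∈ A} K_a φ` (everybody knows). -/
noncomputable def Efml {Agent : Type} [Fintype Agent] (φ : Formula Agent) : Formula Agent :=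
  (Finset.univ : Finset Agent).toList.foldr (fun a ψ => (Formula.know a φ).and ψ) Formula.top

/-- A birelational epistemic model: a poset `(W, ≤)` with triangle-confluent
modal relations `R a` and a `≤`-monotone valuation. -/
structure Model (Agent W : Type) where
  le : W → W → Prop
  R : Agent → W → W → Prop
  V : W → ℕ → Prop
  le_refl : ∀ w, le w w
  le_trans : ∀ w v u, le w v → le v u → le w u
  le_antisymm : ∀ w v, le w v → le v w → w = v
  tri : ∀ a w v u, le w v → R a v u → R a w u
  mono : ∀ w v, le w v → ∀ n, V w n → V v n

/-- The union `R = ⋃_a R_a`. -/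
def Model.Step {Agent W : Type} (M : Model Agent W) (w v : W) : Prop := ∃ a, M.R a w v

/-- Intuitionistic truth in an epistemic model. -/
def Sat {Agent W : Type} (M : Model Agent W) : Formula Agent → W → Prop
  | .bot, _ => False
  | .atom n, w => M.V w n
  | .and φ ψ, w => Sat M φ w ∧ Sat M ψ w
  | .or φ ψ, w => Sat M φ w ∨ Sat M ψ w
  | .imp φ ψ, w => ∀ v, M.le w v → Sat M φ v → Sat M ψ v
  | .know a φ, w => ∀ v, M.R a w v → Sat M φ v
  | .ck φ, w => ∀ v, Relation.ReflTransGen M.Step w v → Sat M φ v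

def Model.IsRefl {Agent W : Type} (M : Model Agent W) : Prop := ∀ a w, M.R a w w

def Model.IsTrans {Agent W : Type} (M : Model Agent W) : Prop :=
  ∀ a w v u, M.R a w v → M.R a v u → M.R a w u

def Model.IsSymm {Agent W : Type} (M : Model Agent W) : Prop :=
  ∀ a w v, M.R a w v → M.R a v w

def Model.IsS4 {Agent W : Type} (M : Model Agent W) : Prop := M.IsRefl ∧ M.IsTrans

def Model.IsS5 {Agent W : Type} (M : Model Agent W) : Prop := M.IsS4 ∧ M.IsSymm

/-- Validity over the class of all epistemic frames. -/
def ValidAll (Agent : Type) (φ : Formula Agent) : Prop :=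
  ∀ (W : Type) (M : Model Agent W) (w : W), Sat M φ w

/-- Validity over the class of reflexive epistemic frames. -/
def ValidRefl (Agent : Type) (φ : Formula Agent) : Prop :=
  ∀ (W : Type) (M : Model Agent W), M.IsRefl → ∀ w : W, Sat M φ w

/-- Validity over the class of S4 epistemic frames. -/
def ValidS4 (Agent : Type) (φ : Formula Agent) : Prop :=
  ∀ (W : Type) (M : Model Agent W), M.IsS4 → ∀ w : W, Sat M φ w

/-- Validity over the class of S5 epistemic frames. -/
def ValidS5 (Agent : Type) (φ : Formula Agent) : Prop :=
  ∀ (W : Type) (M : Model Agent W), M.IsS5 → ∀ w : W, Sat M φ w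

/-- Purely propositional formulae (for intuitionistic tautologies). -/
inductive PropForm : Type
  | bot : PropForm
  | atom : ℕ → PropForm
  | and : PropForm → PropForm → PropForm
  | or : PropForm → PropForm → PropForm
  | imp : PropForm → PropForm → PropForm

/-- Kripke models for intuitionistic propositional logic. -/
structure IModel (W : Type) where
  le : W → W → Prop
  le_refl : ∀ w, le w w
  le_trans : ∀ w v u, le w v → le v u → le w u
  V : W → ℕ → Prop
  mono : ∀ w v, le w v → ∀ n, V w n → V v n

def ISat {W : Type} (M : IModel W) : PropForm → W → Prop
  | .bot, _ => False
  | .atom n, w => M.V w n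
  | .and p q, w => ISat M p w ∧ ISat M q w
  | .or p q, w => ISat M p w ∨ ISat M q w
  | .imp p q, w => ∀ v, M.le w v → ISat M p v → ISat M q v

/-- IPC validity of a propositional formula. -/
def IPCValid (p : PropForm) : Prop := ∀ (W : Type) (M : IModel W) (w : W), ISat M p w

/-- Substitution of `L_ICK`-formulae for atoms in a propositional formula. -/
def PropForm.subst {Agent : Type} (σ : ℕ → Formula Agent) : PropForm → Formula Agent
  | .bot => Formula.bot
  | .atom n => σ n
  | .and p q => (p.subst σ).and (q.subst σ)
  | .or p q => (p.subst σ).or (q.subst σ)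
  | .imp p q => (p.subst σ).imp (q.subst σ)

/-- The four Hilbert systems. -/
inductive Sys : Type
  | ick : Sys
  | ickt : Sys
  | icks4 : Sys
  | icks5 : Sys

/-- Systems containing the factivity axiom `T`. -/
def Sys.hasT : Sys → Prop
  | Sys.ick => False
  | _ => True

/-- Systems containing the positive introspection axiom `S4`. -/
def Sys.hasS4 : Sys → Prop
  | Sys.icks4 => True
  | Sys.icks5 => True
  | _ => False

/-- Systems containing the classicality and negative introspection axioms. -/
def Sys.hasS5 : Sys → Prop
  | Sys.icks5 => True
  | _ => False

/-- Axioms of the Hilbert systems. -/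
inductive Ax (Agent : Type) [Fintype Agent] : Sys → Formula Agent → Prop
  | taut (P : Sys) (p : PropForm) (σ : ℕ → Formula Agent) :
      IPCValid p → Ax Agent P (p.subst σ)
  | axK (P : Sys) (a : Agent) (φ ψ : Formula Agent) :
      Ax Agent P ((Formula.know a (φ.imp ψ)).imp ((Formula.know a φ).imp (Formula.know a ψ)))
  | fix (P : Sys) (φ : Formula Agent) :
      Ax Agent P ((Formula.ck φ).biimp (φ.and (Efml (Formula.ck φ))))
  | axT (P : Sys) (a : Agent) (φ : Formula Agent) :
      P.hasT → Ax Agent P ((Formula.know a φ).imp φ)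
  | axS4 (P : Sys) (a : Agent) (φ : Formula Agent) :
      P.hasS4 → Ax Agent P ((Formula.know a φ).imp (Formula.know a (Formula.know a φ)))
  | axKc (P : Sys) (a : Agent) (φ ψ : Formula Agent) :
      P.hasS5 → Ax Agent P (((Formula.know a φ).imp ψ).imp (((Formula.know a φ).neg).or ψ))
  | axS5 (P : Sys) (a : Agent) (φ : Formula Agent) :
      P.hasS5 → Ax Agent P (((Formula.know a φ).neg).imp (Formula.know a ((Formula.know a φ).neg)))

/-- Theoremhood (derivability without assumptions) in system `P`. -/
inductive Thm (Agent : Type) [Fintype Agent] (P : Sys) : Formula Agent → Prop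
  | ax {φ : Formula Agent} : Ax Agent P φ → Thm Agent P φ
  | mp {φ ψ : Formula Agent} : Thm Agent P (φ.imp ψ) → Thm Agent P φ → Thm Agent P ψ
  | nec {φ : Formula Agent} (a : Agent) : Thm Agent P φ → Thm Agent P (Formula.know a φ)
  | mon {φ ψ : Formula Agent} :
      Thm Agent P (φ.imp ψ) → Thm Agent P ((Formula.ck φ).imp (Formula.ck ψ))
  | ind {φ : Formula Agent} :
      Thm Agent P (φ.imp (Efml φ)) → Thm Agent P (φ.imp (Formula.ck φ))

/-- Derivability of `φ` from assumptions `Γ` in system `P`: the rules of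
necessitation, monotonicity and induction may only be applied in
assumption-free subderivations. -/
inductive Deriv (Agent : Type) [Fintype Agent] (P : Sys) (Γ : Set (Formula Agent)) :
    Formula Agent → Prop
  | assum {φ : Formula Agent} : φ ∈ Γ → Deriv Agent P Γ φ
  | thm {φ : Formula Agent} : Thm Agent P φ → Deriv Agent P Γ φ
  | mp {φ ψ : Formula Agent} :
      Deriv Agent P Γ (φ.imp ψ) → Deriv Agent P Γ φ → Deriv Agent P Γ ψ

/-- Truth is preserved along the intuitionistic order. -/
theorem Sat.mono {Agent W : Type} (M : Model Agent W) (φ : Formula Agent) {w v : W}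
    (hwv : M.le w v) (h : Sat M φ w) : Sat M φ v := by
  induction φ with
  | bot => exact h
  | atom n => exact M.mono w v hwv n h
  | and φ ψ ihφ ihψ => exact ⟨ihφ h.1, ihψ h.2⟩
  | or φ ψ ihφ ihψ => exact Or.imp ihφ ihψ h
  | imp φ ψ _ _ => exact fun u hvu => h u (M.le_trans w v u hwv hvu)
  | know a φ _ => exact fun u hvu => h u (M.tri a w v u hwv hvu)
  | ck φ ih =>
    intro u hvu
    rcases hvu.cases_head with rfl | ⟨x, ⟨a, hvx⟩, hxu⟩
    · exact ih (h w .refl)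
    · exact h u (.head ⟨a, M.tri a w v x hwv hvx⟩ hxu)

theorem sat_Efml {Agent W : Type} [Fintype Agent] (M : Model Agent W) (φ : Formula Agent)
    (w : W) : Sat M (Efml φ) w ↔ ∀ a, Sat M (Formula.know a φ) w := by
  have sat_foldr (l : List Agent) :
      Sat M (l.foldr (fun a ψ => (Formula.know a φ).and ψ) Formula.top) w ↔
        ∀ a ∈ l, Sat M (Formula.know a φ) w := by
    induction l with
    | nil => simp [Formula.top, Sat]
    | cons a l ih => rw [List.foldr_cons, List.forall_mem_cons, ← ih]; rfl
  simpa [Efml] using sat_foldr (Finset.univ : Finset Agent).toList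

/-- The intuitionistic Kripke model on the worlds of `M` in which the atom `n` is
interpreted as `σ n`. -/
def Model.toIModel {Agent W : Type} (M : Model Agent W) (σ : ℕ → Formula Agent) : IModel W where
  le := M.le
  le_refl := M.le_refl
  le_trans := M.le_trans
  V w n := Sat M (σ n) w
  mono _ _ hwv n := Sat.mono M (σ n) hwv

theorem sat_subst {Agent W : Type} (M : Model Agent W) (σ : ℕ → Formula Agent) (p : PropForm)
    (w : W) : Sat M (p.subst σ) w ↔ ISat (M.toIModel σ) p w := by
  induction p generalizing w with
  | bot => rfl
  | atom n => rfl
  | and p q ihp ihq => exact and_congr (ihp w) (ihq w)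
  | or p q ihp ihq => exact or_congr (ihp w) (ihq w)
  | imp p q ihp ihq =>
    exact forall_congr' fun v => imp_congr_right fun _ => imp_congr (ihp v) (ihq v)

/-- In an S5 model, worlds comparable in the intuitionistic order know the same formulae. -/
theorem sat_know_of_le {Agent W : Type} {M : Model Agent W} (hM : M.IsS5) {a : Agent}
    {φ : Formula Agent} {w v : W} (hwv : M.le w v) (h : Sat M (Formula.know a φ) v) :
    Sat M (Formula.know a φ) w :=
  fun u hwu => h u (hM.1.2 a v w u (hM.2 a w v (M.tri a w v v hwv (hM.1.1 a v))) hwu)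

theorem sat_ck_iff {Agent W : Type} (M : Model Agent W) (φ : Formula Agent) (w : W) :
    Sat M (Formula.ck φ) w ↔
      Sat M φ w ∧ ∀ a, Sat M (Formula.know a (Formula.ck φ)) w := by
  constructor
  · exact fun h => ⟨h w .refl, fun a v hwv u hvu => h u (.head ⟨a, hwv⟩ hvu)⟩
  · rintro ⟨h, hK⟩ u hwu
    rcases hwu.cases_head with rfl | ⟨v, ⟨a, hwv⟩, hvu⟩
    · exact h
    · exact hK a v hwv u hvu

/-- The axioms of `P` hold in every model satisfying the frame conditions of `P`. -/
theorem Ax.sat {Agent W : Type} [Fintype Agent] {P : Sys} {φ : Formula Agent}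
    (h : Ax Agent P φ) (M : Model Agent W) (hT : P.hasT → M.IsRefl) (hS4 : P.hasS4 → M.IsTrans)
    (hS5 : P.hasS5 → M.IsS5) (w : W) : Sat M φ w := by
  cases h with
  | taut p σ hp => exact (sat_subst M σ p w).2 (hp W (M.toIModel σ) w)
  | axK a φ ψ =>
    intro v _ himp u hvu hφ x hux
    exact himp x (M.tri a v u x hvu hux) x (M.le_refl x) (hφ x hux)
  | fix φ =>
    have key (v : W) : Sat M (Formula.ck φ) v ↔ Sat M (φ.and (Efml (Formula.ck φ))) v :=
      (sat_ck_iff M φ v).trans (and_congr_right fun _ => (sat_Efml M _ v).symm)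
    exact ⟨fun v _ => (key v).1, fun v _ => (key v).2⟩
  | axT a φ hP => exact fun v _ hK => hK v (hT hP a v)
  | axS4 a φ hP => exact fun v _ hK u hvu x hux => hK x (hS4 hP a v u x hvu hux)
  | axKc a φ ψ hP =>
    intro v _ himp
    by_cases hK : Sat M (Formula.know a φ) v
    · exact Or.inr (himp v (M.le_refl v) hK)
    · exact Or.inl fun u hvu hu => hK (sat_know_of_le (hS5 hP) hvu hu)
  | axS5 a φ hP =>
    intro v _ hneg u hvu x hux hx
    exact hneg v (M.le_refl v) fun y hvy =>
      sat_know_of_le (hS5 hP) hux hx y ((hS5 hP).1.2 a u v y ((hS5 hP).2 a v u hvu) hvy)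

/-- The theorems of `P` hold in every model satisfying the frame conditions of `P`. -/
theorem Thm.sat {Agent W : Type} [Fintype Agent] {P : Sys} {φ : Formula Agent}
    (h : Thm Agent P φ) (M : Model Agent W) (hT : P.hasT → M.IsRefl) (hS4 : P.hasS4 → M.IsTrans)
    (hS5 : P.hasS5 → M.IsS5) (w : W) : Sat M φ w := by
  induction h generalizing w with
  | ax h => exact h.sat M hT hS4 hS5 w
  | mp _ _ ihimp ih => exact ihimp w w (M.le_refl w) (ih w)
  | nec a _ ih => exact fun v _ => ih v
  | mon _ ih => exact fun v _ hφ u hvu => ih u u (M.le_refl u) (hφ u hvu)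
  | ind _ ih =>
    intro v _ hφ u hvu
    induction hvu with
    | refl => exact hφ
    | tail _ hstep ihφ =>
      obtain ⟨a, ha⟩ := hstep
      exact (sat_Efml M _ _).1 (ih _ _ (M.le_refl _) ihφ) a _ ha

theorem Deriv.toThm {Agent : Type} [Fintype Agent] {P : Sys} {φ : Formula Agent}
    (h : Deriv Agent P ∅ φ) : Thm Agent P φ := by
  induction h with
  | assum h => exact absurd h (Set.notMem_empty _)
  | thm h => exact h
  | mp _ _ ihimp ih => exact .mp ihimp ih

/-- Soundness of the four axiomatizations. -/
theorem soundness (Agent : Type) [Fintype Agent] [Nonempty Agent] (φ : Formula Agent) :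
    (Deriv Agent Sys.ick ∅ φ → ValidAll Agent φ) ∧
    (Deriv Agent Sys.ickt ∅ φ → ValidRefl Agent φ) ∧
    (Deriv Agent Sys.icks4 ∅ φ → ValidS4 Agent φ) ∧
    (Deriv Agent Sys.icks5 ∅ φ → ValidS5 Agent φ) := by
  refine ⟨fun h W M w => ?_, fun h W M hM w => ?_, fun h W M hM w => ?_, fun h W M hM w => ?_⟩
  · exact h.toThm.sat M False.elim False.elim False.elim w
  · exact h.toThm.sat M (fun _ => hM) False.elim False.elim w
  · exact h.toThm.sat M (fun _ => hM.1) (fun _ => hM.2) False.elim w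
  · exact h.toThm.sat M (fun _ => hM.1.1) (fun _ => hM.1.2) (fun _ => hM) w

end ICK
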